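/- arXiv:2310.00846 — 2 statements merged into one kernel-verified Lean document; each statement's English description precedes it below -/
import Mathlib

section
/- Let m ≥ 1 and let M and M̃ be m×m integer matrices with all entries in {−1,0,1}, and set n = 2m, A = [[0, M],[Mᵀ, 0]] and Ã = [[0, M̃],[M̃ᵀ, 0]] (block matrices of order n). Suppose det(xI−A)=det(xI−Ã), det(xI−(J−I−A))=det(xI−(J−I−Ã)), and the characteristic polynomial of A is irreducible over ℚ. Then there exist m×m rational orthogonal matrices Q₁ and Q₂ with Q₁e = e and Q₂e = e such that, setting Q = [[Q₁,0],[0,Q₂]] or Q = [[0,Q₁],[Q₂,0]], one has QᵀAQ = Ã. -/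
open Matrix Polynomial

section
variable {ι : Type*} [Fintype ι] [DecidableEq ι]

theorem isUnit_aeval_of_irreducible_charpoly {A : Matrix ι ι ℚ} (hA : Irreducible A.charpoly)
    {p : ℚ[X]} (hp : ¬ A.charpoly ∣ p) : IsUnit (aeval A p) := by
  obtain ⟨u, v, huv⟩ := hA.coprime_iff_not_dvd.2 hp
  have h := congrArg (aeval A) huv
  simp only [map_add, map_mul, aeval_self_charpoly, mul_zero, zero_add, map_one] at h
  exact IsUnit.of_mul_eq_one_right _ h

/-- The walk matrix of `A`, with columns the vectors `A ^ k *ᵥ 1`. -/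
noncomputable def walkMatrix (A : Matrix ι ι ℚ) : Matrix ι ι ℚ :=
  Matrix.of fun i j => (A ^ (Fintype.equivFin ι j : ℕ) *ᵥ 1) i

theorem walkMatrix_mulVec (A : Matrix ι ι ℚ) (v : ι → ℚ) :
    walkMatrix A *ᵥ v = aeval A (∑ j, C (v j) * X ^ (Fintype.equivFin ι j : ℕ)) *ᵥ 1 := by
  ext i
  simp only [walkMatrix, map_sum, map_mul, aeval_C, map_pow, aeval_X, sum_mulVec,
    Finset.sum_apply, Algebra.algebraMap_eq_smul_one, smul_mul_assoc, one_mul, smul_mulVec,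
    Pi.smul_apply, smul_eq_mul]
  simp only [mulVec, dotProduct, Matrix.of_apply, mul_comm]

theorem col_mul_walkMatrix (B A : Matrix ι ι ℚ) (j : ι) :
    (B * walkMatrix A).col j = B *ᵥ A ^ (Fintype.equivFin ι j : ℕ) *ᵥ 1 := by
  ext i
  simp [mul_apply, walkMatrix, mulVec, dotProduct]

theorem isUnit_walkMatrix [Nonempty ι] {A : Matrix ι ι ℚ} (hA : Irreducible A.charpoly) :
    IsUnit (walkMatrix A) := by
  rw [isUnit_iff_isUnit_det, isUnit_iff_ne_zero, Ne, ← exists_mulVec_eq_zero_iff]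
  rintro ⟨v, hv, h⟩
  rw [walkMatrix_mulVec] at h
  set p : ℚ[X] := ∑ j, C (v j) * X ^ (Fintype.equivFin ι j : ℕ) with hp
  have hcoeff (j : ι) : p.coeff (Fintype.equivFin ι j) = v j := by
    simp [hp, finsetSum_coeff, coeff_X_pow, Fin.val_inj]
  have hdeg : p.degree < A.charpoly.degree := by
    rw [charpoly_degree_eq_dim, degree_lt_iff_coeff_zero]
    intro k hk
    simp only [hp, finsetSum_coeff, coeff_C_mul, coeff_X_pow]
    refine Finset.sum_eq_zero fun j _ => ?_
    rw [if_neg (by have := (Fintype.equivFin ι j).2; omega), mul_zero]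
  have hp0 : p ≠ 0 := by
    intro h0
    refine hv (funext fun j => ?_)
    rw [← hcoeff, h0, coeff_zero, Pi.zero_apply]
  have hu := isUnit_aeval_of_irreducible_charpoly hA
    (fun hd => hp0 (eq_zero_of_dvd_of_degree_lt hd hdeg))
  have h1 : (1 : ι → ℚ) = 0 := by
    apply mulVec_injective_of_isUnit hu
    rw [h, mulVec_zero]
  exact one_ne_zero (congrFun h1 (Classical.arbitrary ι))

theorem exists_aeval_eq_of_commute [Nonempty ι] {A B : Matrix ι ι ℚ}
    (hA : Irreducible A.charpoly) (hAB : Commute A B) : ∃ q : ℚ[X], B = aeval A q := by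
  have hW := isUnit_walkMatrix hA
  obtain ⟨v, hv⟩ := mulVec_surjective_iff_isUnit.2 hW (B *ᵥ 1)
  rw [walkMatrix_mulVec] at hv
  set q : ℚ[X] := ∑ j, C (v j) * X ^ (Fintype.equivFin ι j : ℕ)
  refine ⟨q, hW.mul_left_injective ?_⟩
  refine Matrix.ext_col fun j => ?_
  have hq : Commute (A ^ (Fintype.equivFin ι j : ℕ)) (aeval A q) := by
    rw [← aeval_X_pow (R := ℚ) A, Commute, SemiconjBy, ← map_mul, ← map_mul, mul_comm]
  simp only [col_mul_walkMatrix]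
  rw [mulVec_mulVec, ← (hAB.pow_left _).eq, ← mulVec_mulVec, ← hv, mulVec_mulVec, mulVec_mulVec,
    hq.eq]

theorem eq_one_or_eq_neg_one_of_commute [Nonempty ι] {A B : Matrix ι ι ℚ}
    (hsymm : A.IsSymm) (hA : Irreducible A.charpoly) (hAB : Commute A B)
    (hB : B * Bᵀ = 1) : B = 1 ∨ B = -1 := by
  obtain ⟨q, rfl⟩ := exists_aeval_eq_of_commute hA hAB
  have ht : (aeval A q)ᵀ = aeval A q := by
    clear hAB hB
    induction q using Polynomial.induction_on' with
    | add p q hp hq => rw [map_add, transpose_add, hp, hq]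
    | monomial k a => simp [aeval_monomial, Algebra.algebraMap_eq_smul_one, transpose_pow, hsymm.eq]
  rw [ht] at hB
  have h0 : aeval A (q - 1) * aeval A (q + 1) = 0 := by
    simp only [map_sub, map_add, map_one]
    rw [sub_mul, one_mul, mul_add, mul_one, hB]
    abel
  by_cases hd : A.charpoly ∣ q - 1
  · left
    obtain ⟨r, hr⟩ := hd
    have := congrArg (aeval A) hr
    rwa [map_mul, aeval_self_charpoly, zero_mul, map_sub, map_one, sub_eq_zero] at this
  · right
    have := (isUnit_aeval_of_irreducible_charpoly hA hd).mul_right_eq_zero.1 h0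
    rwa [map_add, map_one, ← eq_neg_iff_add_eq_zero] at this

/-- If `Qᵀ * A * Q = C` with `A` irreducible and the symmetric involution `D` negates both `A` and
`C`, then `Q` commutes or anticommutes with `D`. -/
theorem eq_or_eq_neg_of_anticommute [Nonempty ι] {A C D Q : Matrix ι ι ℚ} (hA : A.IsSymm)
    (hirr : Irreducible A.charpoly) (hQ : Qᵀ * Q = 1) (hQA : Qᵀ * A * Q = C) (hDs : D.IsSymm)
    (hD : D * D = 1) (hDA : D * A = -(A * D)) (hDC : D * C = -(C * D)) :
    Q * D = D * Q ∨ Q * D = -(D * Q) := by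
  have hQ' : Q * Qᵀ = 1 := mul_eq_one_comm.1 hQ
  have h1 : A * Q = Q * C := by rw [← hQA, ← mul_assoc, ← mul_assoc, hQ', one_mul]
  have h2 : Qᵀ * A = C * Qᵀ := by rw [← hQA, mul_assoc, hQ', mul_one]
  have hcomm : Commute A (D * (Q * D * Qᵀ)) := by
    symm
    calc D * (Q * D * Qᵀ) * A = D * Q * D * (Qᵀ * A) := by simp only [mul_assoc]
      _ = D * Q * (D * C) * Qᵀ := by rw [h2]; simp only [mul_assoc]
      _ = -(D * (Q * C) * D * Qᵀ) := by
        rw [hDC]; simp only [mul_assoc, mul_neg, neg_mul]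
      _ = -(D * A * Q * D * Qᵀ) := by rw [← h1]; simp only [mul_assoc]
      _ = A * (D * (Q * D * Qᵀ)) := by
        rw [hDA]; simp only [mul_assoc, neg_mul, neg_neg]
  have horth : D * (Q * D * Qᵀ) * (D * (Q * D * Qᵀ))ᵀ = 1 := by
    calc _ = D * Q * D * (Qᵀ * Q) * D * Qᵀ * D := by
          simp only [transpose_mul, transpose_transpose, hDs.eq, mul_assoc]
      _ = D * Q * (D * D) * Qᵀ * D := by rw [hQ]; simp only [mul_assoc, mul_one]
      _ = D * (Q * Qᵀ) * D := by rw [hD]; simp only [mul_assoc, one_mul]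
      _ = 1 := by rw [hQ', mul_one, hD]
  have h3 : Q * D = D * (D * (Q * D * Qᵀ)) * Q := by
    calc Q * D = (D * D) * Q * D * (Qᵀ * Q) := by rw [hD, hQ, one_mul, mul_one]
      _ = _ := by simp only [mul_assoc]
  rcases eq_one_or_eq_neg_one_of_commute hA hirr hcomm horth with h | h <;> rw [h] at h3
  · left; rwa [mul_one] at h3
  · right; rwa [mul_neg, mul_one, neg_mul] at h3

theorem charpoly_neg_one_sub (A : Matrix ι ι ℚ) :
    (-1 - A).charpoly = (-1) ^ Fintype.card ι * A.charpoly.comp (-1 - X) := by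
  refine Polynomial.funext fun t => ?_
  simp only [eval_charpoly, eval_mul, eval_comp, eval_sub, eval_neg, eval_one, eval_X, eval_pow]
  rw [← det_neg, map_sub, map_neg, map_one]
  congr 1
  abel

open PowerSeries in
theorem det_one_sub_X_smul_eq_charpolyRev (B : Matrix ι ι ℚ) :
    (1 - (PowerSeries.X : ℚ⟦X⟧) • B.map (PowerSeries.C (R := ℚ))).det = (B.charpolyRev : ℚ⟦X⟧) := by
  rw [charpolyRev, ← Polynomial.coeToPowerSeries.ringHom_apply, RingHom.map_det]
  congr 1
  ext i j : 1
  rcases eq_or_ne i j with rfl | hij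
  · simp [mul_comm (PowerSeries.X : ℚ⟦X⟧)]
  · simp [Matrix.one_apply_ne hij, mul_comm (PowerSeries.X : ℚ⟦X⟧)]

open PowerSeries in
/-- The generating function of the powers of `B`. -/
noncomputable def walkSeries (B : Matrix ι ι ℚ) : Matrix ι ι ℚ⟦X⟧ :=
  Matrix.of fun i j => PowerSeries.mk fun k => (B ^ k) i j

open PowerSeries in
theorem one_sub_mul_walkSeries (B : Matrix ι ι ℚ) :
    (1 - (PowerSeries.X : ℚ⟦X⟧) • B.map (PowerSeries.C (R := ℚ))) * walkSeries B = 1 := by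
  rw [Matrix.sub_mul, one_mul, smul_mul]
  ext i j k
  cases k with
  | zero => simp [walkSeries, Matrix.one_apply, apply_ite]
  | succ k =>
    simp [walkSeries, Matrix.one_apply, apply_ite, mul_apply, pow_succ',
      PowerSeries.coeff_succ_X_mul]

open PowerSeries in
theorem charpolyRev_add_ones (B : Matrix ι ι ℚ) :
    ((B + Matrix.of fun _ _ => 1).charpolyRev : ℚ⟦X⟧) = (B.charpolyRev : ℚ⟦X⟧) *
      (1 - PowerSeries.X * PowerSeries.mk fun k => 1 ⬝ᵥ B ^ k *ᵥ 1) := by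
  rw [← det_one_sub_X_smul_eq_charpolyRev, ← det_one_sub_X_smul_eq_charpolyRev]
  have hN := one_sub_mul_walkSeries B
  set N := 1 - (PowerSeries.X : ℚ⟦X⟧) • B.map (PowerSeries.C (R := ℚ)) with hNdef
  have hu : IsUnit N.det := isUnit_det_of_right_inverse hN
  have h1 : 1 - (PowerSeries.X : ℚ⟦X⟧) • (B + Matrix.of fun _ _ => 1).map (PowerSeries.C (R := ℚ))
      = N + replicateCol Unit (fun _ : ι => -(PowerSeries.X : ℚ⟦X⟧)) *
          replicateRow Unit (fun _ : ι => (1 : ℚ⟦X⟧)) := by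
    ext i j : 1
    simp [hNdef, mul_apply]
    ring
  rw [h1, det_add_replicateCol_mul_replicateRow hu, inv_eq_right_inv hN]
  congr 1
  rw [det_unique]
  ext k : 1
  cases k with
  | zero => simp [mul_apply, walkSeries]
  | succ k =>
    simp [mul_apply, walkSeries, dotProduct, mulVec, PowerSeries.coeff_succ_X_mul,
      PowerSeries.coeff_one,
      Finset.sum_comm (f := fun i j => (B ^ k) i j)]

theorem dotProduct_pow_mulVec_eq {B C : Matrix ι ι ℚ} (h : B.charpoly = C.charpoly)
    (hJ : (B + Matrix.of fun _ _ => 1).charpoly = (C + Matrix.of fun _ _ => 1).charpoly) (k : ℕ) :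
    (1 : ι → ℚ) ⬝ᵥ B ^ k *ᵥ 1 = 1 ⬝ᵥ C ^ k *ᵥ 1 := by
  have h1 := charpolyRev_add_ones B
  rw [← reverse_charpoly, hJ, reverse_charpoly, charpolyRev_add_ones, ← reverse_charpoly B, h,
    reverse_charpoly] at h1
  have h0 : (C.charpolyRev : PowerSeries ℚ) ≠ 0 := by
    intro h
    have := congrArg PowerSeries.constantCoeff h
    simp [coeff_zero_eq_eval_zero] at this
  have h2 := congrArg (PowerSeries.coeff (k + 1)) (mul_left_cancel₀ h0 h1)
  simpa [PowerSeries.coeff_succ_X_mul, PowerSeries.coeff_one] using h2.symm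

theorem dotProduct_aeval_mulVec_eq {B C : Matrix ι ι ℚ}
    (h : ∀ k : ℕ, (1 : ι → ℚ) ⬝ᵥ B ^ k *ᵥ 1 = 1 ⬝ᵥ C ^ k *ᵥ 1) (p : ℚ[X]) :
    (1 : ι → ℚ) ⬝ᵥ aeval B p *ᵥ 1 = 1 ⬝ᵥ aeval C p *ᵥ 1 := by
  induction p using Polynomial.induction_on' with
  | add p q hp hq => simp only [map_add, add_mulVec, dotProduct_add, hp, hq]
  | monomial k a => simp only [aeval_monomial, Algebra.algebraMap_eq_smul_one, smul_mul_assoc,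
      one_mul, smul_mulVec, dotProduct_smul, h]

theorem dotProduct_pow_mulVec_eq_of_compl {A C : Matrix ι ι ℚ} (h : A.charpoly = C.charpoly)
    (hJ : ((Matrix.of fun _ _ => 1) - 1 - A).charpoly
      = ((Matrix.of fun _ _ => 1) - 1 - C).charpoly) (k : ℕ) :
    (1 : ι → ℚ) ⬝ᵥ A ^ k *ᵥ 1 = 1 ⬝ᵥ C ^ k *ᵥ 1 := by
  have e (A : Matrix ι ι ℚ) :
      (Matrix.of fun _ _ => 1) - 1 - A = (-1 - A) + Matrix.of fun _ _ => 1 := by abel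
  have hA (A : Matrix ι ι ℚ) : A ^ k = aeval (-1 - A) ((-1 - X : ℚ[X]) ^ k) := by simp
  rw [e, e] at hJ
  rw [hA A, hA C]
  refine dotProduct_aeval_mulVec_eq (dotProduct_pow_mulVec_eq ?_ hJ) _
  rw [charpoly_neg_one_sub, charpoly_neg_one_sub, h]

theorem walkMatrix_transpose_mul_mul {A : Matrix ι ι ℚ} (hA : A.IsSymm) (l : ℕ) (i j : ι) :
    ((walkMatrix A)ᵀ * A ^ l * walkMatrix A) i j =
      1 ⬝ᵥ A ^ (Fintype.equivFin ι i + l + Fintype.equivFin ι j : ℕ) *ᵥ 1 := by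
  have h1 : ((walkMatrix A)ᵀ * A ^ l * walkMatrix A) i j =
      (A ^ (Fintype.equivFin ι i : ℕ) *ᵥ 1) ⬝ᵥ (A ^ l * walkMatrix A).col j := by
    rw [mul_assoc, mul_apply]; rfl
  rw [h1, col_mul_walkMatrix, dotProduct_mulVec, ← vecMul_transpose, (hA.pow _).eq,
    vecMul_vecMul, ← dotProduct_mulVec, mulVec_mulVec, ← pow_add, ← pow_add]

/-- Two symmetric matrices that are generalized cospectral, with irreducible characteristic
polynomial, are conjugate by a regular rational orthogonal matrix. -/
theorem exists_orthogonal_regular [Nonempty ι] {A C : Matrix ι ι ℚ} (hA : A.IsSymm) (hC : C.IsSymm)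
    (hirr : Irreducible A.charpoly) (h : A.charpoly = C.charpoly)
    (hJ : ((Matrix.of fun _ _ => 1) - 1 - A).charpoly
      = ((Matrix.of fun _ _ => 1) - 1 - C).charpoly) :
    ∃ Q : Matrix ι ι ℚ, Qᵀ * Q = 1 ∧ Q *ᵥ 1 = 1 ∧ Qᵀ * A * Q = C := by
  have hW : (walkMatrix C) * (walkMatrix C)⁻¹ = 1 :=
    mul_nonsing_inv _ ((isUnit_iff_isUnit_det _).1 (isUnit_walkMatrix (h ▸ hirr)))
  have hW' : (walkMatrix C)⁻¹ * walkMatrix C = 1 := mul_eq_one_comm.1 hW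
  have hG (l : ℕ) : (walkMatrix A * (walkMatrix C)⁻¹)ᵀ * A ^ l * (walkMatrix A * (walkMatrix C)⁻¹)
      = C ^ l := by
    have : (walkMatrix A)ᵀ * A ^ l * walkMatrix A = (walkMatrix C)ᵀ * C ^ l * walkMatrix C := by
      ext i j
      rw [walkMatrix_transpose_mul_mul hA, walkMatrix_transpose_mul_mul hC,
        dotProduct_pow_mulVec_eq_of_compl h hJ]
    calc _ = ((walkMatrix C)⁻¹)ᵀ * ((walkMatrix A)ᵀ * A ^ l * walkMatrix A) * (walkMatrix C)⁻¹ := by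
          simp only [transpose_mul, mul_assoc]
      _ = (walkMatrix C * (walkMatrix C)⁻¹)ᵀ * C ^ l * (walkMatrix C * (walkMatrix C)⁻¹) := by
          rw [this]; simp only [transpose_mul, mul_assoc]
      _ = C ^ l := by simp [hW]
  refine ⟨walkMatrix A * (walkMatrix C)⁻¹, by simpa using hG 0, ?_, by simpa using hG 1⟩
  have hcol (A : Matrix ι ι ℚ) : walkMatrix A *ᵥ Pi.single
      ((Fintype.equivFin ι).symm ⟨0, Fintype.card_pos⟩) 1 = 1 := by
    ext i
    simp [walkMatrix]
  nth_rw 1 [← hcol C]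
  rw [mulVec_mulVec, mul_assoc, hW', mul_one, hcol]

end

theorem stmt6 {m : ℕ} (hm : 1 ≤ m)
    (M Mt : Matrix (Fin m) (Fin m) ℤ)
    (hM : ∀ i j, M i j = -1 ∨ M i j = 0 ∨ M i j = 1)
    (hMt : ∀ i j, Mt i j = -1 ∨ Mt i j = 0 ∨ Mt i j = 1)
    (hcospec : (Matrix.fromBlocks 0 M Mᵀ 0).charpoly
        = (Matrix.fromBlocks 0 Mt Mtᵀ 0).charpoly)
    (hcospecc : ((Matrix.of fun _ _ => (1 : ℤ)) - 1 - Matrix.fromBlocks 0 M Mᵀ 0).charpoly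
        = ((Matrix.of fun _ _ => (1 : ℤ)) - 1 - Matrix.fromBlocks 0 Mt Mtᵀ 0).charpoly)
    (hirr : Irreducible
      ((Matrix.fromBlocks 0 M Mᵀ 0).charpoly.map (Int.castRingHom ℚ))) :
    ∃ Q₁ Q₂ : Matrix (Fin m) (Fin m) ℚ,
      Q₁ᵀ * Q₁ = 1 ∧ Q₂ᵀ * Q₂ = 1 ∧
      (Q₁ *ᵥ fun _ => (1 : ℚ)) = (fun _ => (1 : ℚ)) ∧
      (Q₂ *ᵥ fun _ => (1 : ℚ)) = (fun _ => (1 : ℚ)) ∧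
      ((Matrix.fromBlocks Q₁ 0 0 Q₂)ᵀ
          * (Matrix.fromBlocks 0 M Mᵀ 0).map ((↑) : ℤ → ℚ)
          * Matrix.fromBlocks Q₁ 0 0 Q₂
          = (Matrix.fromBlocks 0 Mt Mtᵀ 0).map ((↑) : ℤ → ℚ)
        ∨ (Matrix.fromBlocks 0 Q₁ Q₂ 0)ᵀ
          * (Matrix.fromBlocks 0 M Mᵀ 0).map ((↑) : ℤ → ℚ)
          * Matrix.fromBlocks 0 Q₁ Q₂ 0
          = (Matrix.fromBlocks 0 Mt Mtᵀ 0).map ((↑) : ℤ → ℚ)) := by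
  have : Nonempty (Fin m) := ⟨⟨0, hm⟩⟩
  have hJmap (N : Matrix (Fin m ⊕ Fin m) (Fin m ⊕ Fin m) ℤ) :
      ((Matrix.of fun _ _ => (1 : ℤ)) - 1 - N).map (Int.castRingHom ℚ) =
        (Matrix.of fun _ _ => (1 : ℚ)) - 1 - N.map (Int.castRingHom ℚ) := by
    ext i j
    simp [Matrix.one_apply, apply_ite]
  have hsymm (N : Matrix (Fin m) (Fin m) ℤ) :
      ((Matrix.fromBlocks 0 N Nᵀ 0).map (Int.castRingHom ℚ)).IsSymm :=
    (IsSymm.fromBlocks isSymm_zero rfl isSymm_zero).map _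
  have hanti (N : Matrix (Fin m) (Fin m) ℤ) :
      Matrix.fromBlocks 1 0 0 (-1) * (Matrix.fromBlocks 0 N Nᵀ 0).map (Int.castRingHom ℚ)
        = -((Matrix.fromBlocks 0 N Nᵀ 0).map (Int.castRingHom ℚ) *
          Matrix.fromBlocks 1 0 0 (-1)) := by
    simp [fromBlocks_map, fromBlocks_multiply, fromBlocks_neg]
  obtain ⟨Q, hQ, hQe, hQA⟩ := exists_orthogonal_regular (hsymm M) (hsymm Mt)
    (by rwa [charpoly_map]) (by rw [charpoly_map, charpoly_map, hcospec])
    (by rw [← hJmap, ← hJmap, charpoly_map, charpoly_map, hcospecc])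
  have hD := eq_or_eq_neg_of_anticommute (hsymm M) (by rwa [charpoly_map]) hQ hQA
    (D := Matrix.fromBlocks 1 0 0 (-1)) (by simp [IsSymm, fromBlocks_transpose])
    (by simp [fromBlocks_multiply]) (hanti M) (hanti Mt)
  change Qᵀ * (Matrix.fromBlocks 0 M Mᵀ 0).map ((↑) : ℤ → ℚ) * Q
    = (Matrix.fromBlocks 0 Mt Mtᵀ 0).map ((↑) : ℤ → ℚ) at hQA
  obtain ⟨a, b, c, d, rfl⟩ : ∃ a b c d, Q = fromBlocks a b c d :=
    ⟨_, _, _, _, (fromBlocks_toBlocks Q).symm⟩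
  rw [← Sum.elim_one_one, fromBlocks_mulVec] at hQe
  simp only [fromBlocks_multiply, fromBlocks_neg, fromBlocks_inj, Matrix.mul_zero, Matrix.zero_mul,
    mul_one, one_mul, mul_neg, neg_mul, add_zero, zero_add] at hD
  have hzero (N : Matrix (Fin m) (Fin m) ℚ) (h : N = -N) : N = 0 := by
    ext i j
    exact self_eq_neg.1 (congrFun (congrFun h i) j)
  simp only [Sum.elim_comp_inl, Sum.elim_comp_inr, Sum.elim_eq_iff] at hQe
  rw [fromBlocks_transpose, fromBlocks_multiply, ← fromBlocks_one, fromBlocks_inj] at hQ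
  rcases hD with ⟨-, hb, hc, -⟩ | ⟨ha, -, -, hd⟩
  · obtain rfl := hzero b hb.symm
    obtain rfl := hzero c hc
    simp only [transpose_zero, Matrix.mul_zero, Matrix.zero_mul, add_zero, zero_add, zero_mulVec]
      at hQ hQe
    exact ⟨a, d, hQ.1, hQ.2.2.2, hQe.1, hQe.2, Or.inl hQA⟩
  · obtain rfl := hzero a ha
    obtain rfl := hzero d (by simpa using hd.symm)
    simp only [transpose_zero, Matrix.mul_zero, Matrix.zero_mul, add_zero, zero_add, zero_mulVec]
      at hQ hQe
    exact ⟨b, c, hQ.2.2.2, hQ.1, hQe.1, hQe.2, Or.inr hQA⟩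
end

section
/- Let A be an n×n symmetric integer matrix and let Q be an n×n rational orthogonal matrix such that QᵀAQ is an integer matrix. If the discriminant Δ(A) is an odd square-free integer, then Q is a signed permutation matrix, i.e., every row and every column of Q contains exactly one nonzero entry, and that entry is 1 or −1. -/
open Matrix Polynomial
open scoped Classical

/-- An enumeration of the complex roots (with multiplicity) of a polynomial that has
exactly `n` roots, obtained by choice (and junk otherwise). -/
noncomputable def rootsEnum (n : ℕ) (f : Polynomial ℂ) : Fin n → ℂ :=
  if h : ∃ α : Fin n → ℂ, f.roots = Multiset.map α Finset.univ.val then h.choose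
  else fun _ => 0

/-- The discriminant `∏_{i<j} (αᵢ - αⱼ)²` of a polynomial with `n` complex roots
`α₁, …, αₙ` listed with multiplicity. -/
noncomputable def polyDisc (n : ℕ) (f : Polynomial ℂ) : ℂ :=
  ∏ i : Fin n, ∏ j ∈ Finset.univ.filter (fun j => i < j),
    (rootsEnum n f i - rootsEnum n f j) ^ 2

namespace Matrix

/-- Membership of a determinant in the square of an ideal containing a row and a column. -/
theorem det_mem_sq_of_row_col {n T : Type*} [Fintype n] [DecidableEq n] [CommRing T]
    (M : Matrix n n T) (J : Ideal T) (j : n) (hrow : ∀ k, M j k ∈ J) (hcol : ∀ k, M k j ∈ J)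
    (hdiag : M j j ∈ J ^ 2) : M.det ∈ J ^ 2 := by
  rw [det_apply]
  refine Ideal.sum_mem _ fun σ _ => ?_
  rw [Units.smul_def, zsmul_eq_mul]
  refine Ideal.mul_mem_left _ _ ?_
  by_cases h : σ j = j
  · rw [← Finset.mul_prod_erase _ _ (Finset.mem_univ j), h]
    exact Ideal.mul_mem_right _ _ hdiag
  · have h' : σ.symm j ≠ j := fun e => h ((Equiv.symm_apply_eq σ).1 e).symm
    rw [← Finset.mul_prod_erase _ _ (Finset.mem_univ j),
      ← Finset.mul_prod_erase _ _ (Finset.mem_erase.2 ⟨h', Finset.mem_univ _⟩), ← mul_assoc, sq]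
    refine Ideal.mul_mem_right _ _ (Ideal.mul_mem_mul (hcol _) ?_)
    simpa using hrow (σ.symm j)

end Matrix

namespace Polynomial

theorem eval_mem_sq_and_eval_derivative_mem {R : Type*} [CommRing R] (I : Ideal R) (a : R)
    {g : R[X]} (hg : g ∈ (I.comap (evalRingHom a)) ^ 2) :
    g.eval a ∈ I ^ 2 ∧ g.derivative.eval a ∈ I := by
  rw [sq] at hg
  refine Submodule.mul_induction_on hg (fun x hx y hy => ?_) fun x y hx hy => ?_
  · simp only [Ideal.mem_comap, coe_evalRingHom] at hx hy
    refine ⟨?_, ?_⟩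
    · rw [eval_mul, sq]
      exact Ideal.mul_mem_mul hx hy
    · rw [derivative_mul, eval_add, eval_mul, eval_mul]
      exact I.add_mem (I.mul_mem_left _ hy) (I.mul_mem_right _ hx)
  · rw [eval_add, derivative_add, eval_add]
    exact ⟨Ideal.add_mem _ hx.1 hy.1, Ideal.add_mem _ hx.2 hy.2⟩

theorem sq_eval_derivative_dvd_resultant {S : Type*} [CommRing S] [Nontrivial S] {f : S[X]}
    (hf : f.Monic) {a : S} (ha : f.eval a = 0) :
    (f.derivative.eval a) ^ 2 ∣ resultant f f.derivative f.natDegree (f.natDegree - 1) := by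
  obtain ⟨q, rfl⟩ := dvd_iff_isRoot.2 (show f.IsRoot a from ha)
  have hq : q.Monic := (monic_X_sub_C a).of_mul_monic_left hf
  have hdeg : ((X - C a) * q).natDegree = (X - C a).natDegree + q.natDegree :=
    (monic_X_sub_C a).natDegree_mul hq
  have hder : (derivative ((X - C a) * q)).eval a = q.eval a := by simp [derivative_mul]
  set f' := derivative ((X - C a) * q) with hf'
  have hle : f'.natDegree ≤ ((X - C a) * q).natDegree - 1 := natDegree_derivative_le _
  set m := ((X - C a) * q).natDegree - 1 with hm
  rw [hdeg, resultant_mul_left _ _ _ _ hle, natDegree_X_sub_C, resultant_X_sub_C_left _ _ _ hle, sq]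
  refine mul_dvd_mul_left _ ?_
  by_cases h0 : q.natDegree = 0
  · rw [hder, hq.natDegree_eq_zero.1 h0]
    simp
  · obtain ⟨u, w, -, -, h⟩ := exists_mul_add_mul_eq_C_resultant (m := q.natDegree) (n := m)
      q f' le_rfl hle (Or.inl h0)
    have := congrArg (eval a) h
    rw [eval_add, eval_mul, eval_mul, eval_C, ← hder, ← mul_add] at this
    exact ⟨_, this.symm⟩

theorem resultant_derivative_mem_sq {R : Type*} [CommRing R] {f : R[X]} (hf : f.Monic)
    (I : Ideal R) {a : R} (h0 : f.eval a ∈ I ^ 2) (h1 : f.derivative.eval a ∈ I) :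
    resultant f f.derivative f.natDegree (f.natDegree - 1) ∈ I ^ 2 := by
  by_cases hI : I ^ 2 = ⊤
  · simp [hI]
  have : Nontrivial (R ⧸ I ^ 2) := Ideal.Quotient.nontrivial_iff.2 hI
  set φ := Ideal.Quotient.mk (I ^ 2) with hφ
  have h := sq_eval_derivative_dvd_resultant (hf.map φ) (a := φ a)
    (by rw [eval_map_apply]; exact Ideal.Quotient.eq_zero_iff_mem.2 h0)
  rw [derivative_map, eval_map_apply, hf.natDegree_map, resultant_map_map, ← map_pow,
    Ideal.Quotient.eq_zero_iff_mem.2 (Ideal.pow_mem_pow h1 2), zero_dvd_iff] at h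
  exact Ideal.Quotient.eq_zero_iff_mem.1 h

end Polynomial

namespace Matrix

/-- If a symmetric matrix has, modulo an ideal `I`, an isotropic eigenvector `v` with a unit
coordinate, and the relevant values of the form on `v` vanish modulo `I ^ 2`, then the
characteristic polynomial has a degenerate root modulo `I ^ 2`. -/
theorem resultant_charpoly_mem_sq {n R : Type*} [Fintype n] [DecidableEq n] [CommRing R]
    [Nontrivial R] (A : Matrix n n R) (hA : A.IsSymm) (I : Ideal R) (v : n → R) (a : R) (j : n)
    (hj : IsUnit (v j)) (hv : ∀ i, (A *ᵥ v) i - a * v i ∈ I) (hvv : v ⬝ᵥ v ∈ I ^ 2)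
    (hvAv : v ⬝ᵥ A *ᵥ v ∈ I ^ 2) :
    resultant A.charpoly A.charpoly.derivative (Fintype.card n) (Fintype.card n - 1) ∈ I ^ 2 := by
  set U : Matrix n n R := (1 : Matrix n n R).updateCol j v with hU
  have hUj : ∀ i, U i j = v i := fun i => by simp [hU]
  have hdetU : U.det = v j := by
    rw [hU, ← cramer_apply, cramer_one]; rfl
  set M : Matrix n n R[X] := (U.map C)ᵀ * A.charmatrix * U.map C with hM
  have hMsymm : Mᵀ = M := by
    rw [hM, transpose_mul, transpose_mul, transpose_transpose, ← charmatrix_transpose, hA.eq,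
      mul_assoc]
  have hMcol : ∀ k, M k j = X * C (Uᵀ k ⬝ᵥ v) - C (Uᵀ k ⬝ᵥ A *ᵥ v) := by
    intro k
    have h1 : M = (X : R[X]) • (Uᵀ * U).map C - (Uᵀ * A * U).map C := by
      rw [hM, charmatrix, Matrix.mul_sub, Matrix.sub_mul, Matrix.map_mul, Matrix.map_mul,
        Matrix.map_mul, transpose_map, scalar_apply, ← smul_one_eq_diagonal, Matrix.mul_smul,
        Matrix.mul_one, Matrix.smul_mul]
      rfl
    have h2 : (fun i => U i j) = v := funext hUj
    have h3 : (fun i => (A * U) i j) = A *ᵥ v := funext fun i => by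
      rw [mul_apply', h2]; rfl
    rw [h1, mul_assoc, sub_apply, smul_apply, map_apply, map_apply, mul_apply' (M := Uᵀ),
      mul_apply' (M := Uᵀ), h2, h3, smul_eq_mul]
  have hdet : M.det = C (v j) ^ 2 * A.charpoly := by
    have : (U.map C).det = C (v j) := by
      rw [← hdetU]; exact (RingHom.map_det C U).symm
    rw [hM, det_mul, det_mul, det_transpose, this, charpoly]; ring
  have hcol : ∀ k, M k j ∈ I.comap (evalRingHom a) := by
    intro k
    have : (M k j).eval a = ∑ i, U i k * (a * v i - (A *ᵥ v) i) := by
      rw [hMcol]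
      simp only [eval_sub, eval_mul, eval_X, eval_C, dotProduct, Finset.mul_sum, transpose_apply,
        ← Finset.sum_sub_distrib]
      exact Finset.sum_congr rfl fun i _ => by ring
    rw [Ideal.mem_comap, coe_evalRingHom, this]
    refine Ideal.sum_mem _ fun i _ => Ideal.mul_mem_left _ _ ?_
    rw [← neg_sub]
    exact I.neg_mem (hv i)
  have hdiag : M j j ∈ (I.comap (evalRingHom a)) ^ 2 := by
    have h1 : M j j = X * C (v ⬝ᵥ v) - C (v ⬝ᵥ A *ᵥ v) := by
      rw [hMcol, show Uᵀ j = v from funext hUj]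
    have h2 : (I ^ 2).map C ≤ (I.comap (evalRingHom a)) ^ 2 := by
      rw [Ideal.map_pow]
      refine Ideal.pow_right_mono (Ideal.map_le_iff_le_comap.2 fun x hx => ?_) 2
      simpa using hx
    rw [h1]
    exact Ideal.sub_mem _ (Ideal.mul_mem_left _ _ (h2 (Ideal.mem_map_of_mem _ hvv)))
      (h2 (Ideal.mem_map_of_mem _ hvAv))
  have hrow : ∀ k, M j k ∈ I.comap (evalRingHom a) := fun k => by
    rw [← hMsymm]; exact hcol k
  have key := det_mem_sq_of_row_col M _ j hrow hcol hdiag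
  rw [hdet] at key
  have hunit : IsUnit (C (v j) ^ 2 : R[X]) := (hj.map C).pow 2
  have key' := (Ideal.unit_mul_mem_iff_mem _ hunit).1 key
  obtain ⟨h0, h1⟩ := eval_mem_sq_and_eval_derivative_mem I a key'
  have := resultant_derivative_mem_sq A.charpoly_monic I h0 h1
  rwa [charpoly_natDegree_eq_dim] at this

theorem exists_eigenvector_in_range {n m k : Type*} [Fintype n] [Fintype m]
    [DecidableEq n] [DecidableEq m] [Field k] [IsAlgClosed k]
    (A : Matrix n n k) (P : Matrix n m k) (B : Matrix m m k) (hAP : A * P = P * B) (hP : P ≠ 0) :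
    ∃ (c : m → k) (a : k), P *ᵥ c ≠ 0 ∧ A *ᵥ (P *ᵥ c) = a • (P *ᵥ c) := by
  have hinv : ∀ x ∈ LinearMap.range P.mulVecLin, A.mulVecLin x ∈ LinearMap.range P.mulVecLin := by
    rintro _ ⟨c, rfl⟩
    exact ⟨B *ᵥ c, by simp [hAP]⟩
  have hne : LinearMap.range P.mulVecLin ≠ ⊥ := by
    rw [Ne, LinearMap.range_eq_bot]
    intro h
    exact hP ((toLin' (R := k)).map_eq_zero_iff.1 h)
  have : Nontrivial (LinearMap.range P.mulVecLin) := Submodule.nontrivial_iff_ne_bot.2 hne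
  obtain ⟨a, ha⟩ := Module.End.exists_eigenvalue (A.mulVecLin.restrict hinv)
  obtain ⟨⟨_, c, rfl⟩, hx, hx0⟩ := ha.exists_hasEigenvector
  refine ⟨c, a, fun h => hx0 (Subtype.ext h), ?_⟩
  rw [Module.End.mem_eigenspace_iff] at hx
  exact congrArg Subtype.val hx

/-- A primitive integral similarity of a symmetric integer matrix whose level is divisible by `p`
forces the discriminant of the characteristic polynomial to be divisible by `p ^ 2`, and in
particular not to be square-free. -/
theorem not_squarefree_resultant_charpoly {n : Type*} [Fintype n] [DecidableEq n]
    (A : Matrix n n ℤ) (hA : A.IsSymm) (P B : Matrix n n ℤ) (l : ℤ) (p : ℕ) [hp : Fact p.Prime]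
    (hpl : (p : ℤ) ∣ l) (hPP : Pᵀ * P = l ^ 2 • 1) (hAP : A * P = P * B)
    (hP : ∃ i j, ¬ (p : ℤ) ∣ P i j) :
    ¬ Squarefree
      (resultant A.charpoly A.charpoly.derivative (Fintype.card n) (Fintype.card n - 1)) := by
  intro hsq
  set d := resultant A.charpoly A.charpoly.derivative (Fintype.card n) (Fintype.card n - 1) with hd
  let k := AlgebraicClosure (ZMod p)
  have : CharP k p := charP_of_injective_algebraMap (algebraMap (ZMod p) k).injective p
  let W := WittVector p k
  let π : W →+* k := WittVector.constantCoeff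
  let φ : ℤ →+* W := Int.castRingHom W
  let ψ : ℤ →+* k := Int.castRingHom k
  have hπφ : ∀ z, π (φ z) = ψ z := fun z => map_intCast π z
  have hker : ∀ x : W, x ∈ Ideal.span {(p : W)} ↔ π x = 0 := fun x => by
    rw [← WittVector.ker_constantCoeff, RingHom.mem_ker]
  have hψ : ∀ z : ℤ, ψ z = 0 ↔ (p : ℤ) ∣ z := fun z => CharP.intCast_eq_zero_iff k p z
  have hsurj : Function.Surjective π := WittVector.constantCoeff_surjective p
  have hmapmap : ∀ N : Matrix n n ℤ, (N.map φ).map π = N.map ψ := fun N => by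
    ext i j; simp
  obtain ⟨c₀, a₀, hc₀, hev⟩ := exists_eigenvector_in_range (A.map ψ) (P.map ψ) (B.map ψ)
    (by rw [← Matrix.map_mul, hAP, Matrix.map_mul]) (by
      obtain ⟨i, j, hij⟩ := hP
      intro h
      exact hij ((hψ _).1 (congrFun (congrFun h i) j)))
  choose σ hσ using hsurj
  let c : n → W := σ ∘ c₀
  let v : n → W := P.map φ *ᵥ c
  have hπc : π ∘ c = c₀ := funext fun i => hσ _
  have hπv : π ∘ v = P.map ψ *ᵥ c₀ := by
    ext i
    rw [Function.comp_apply, RingHom.map_mulVec, hmapmap, hπc]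
  obtain ⟨j, hj⟩ := Function.ne_iff.1 hc₀
  have hl : φ l ^ 2 ∈ Ideal.span {(p : W)} ^ 2 := by
    refine Ideal.pow_mem_pow ?_ 2
    rw [hker, hπφ, hψ]
    exact hpl
  have hPP' : (P.map φ)ᵀ * P.map φ = φ l ^ 2 • 1 := by
    rw [← transpose_map, ← Matrix.map_mul, hPP]
    ext i j
    rw [map_apply, smul_apply, smul_apply, one_apply, one_apply]
    split_ifs <;> simp
  have hAP' : A.map φ * P.map φ = P.map φ * B.map φ := by
    rw [← Matrix.map_mul, hAP, Matrix.map_mul]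
  have hform : ∀ y, v ⬝ᵥ (P.map φ *ᵥ y) = φ l ^ 2 * (c ⬝ᵥ y) := by
    intro y
    change (P.map φ *ᵥ c) ⬝ᵥ (P.map φ *ᵥ y) = _
    rw [dotProduct_mulVec, ← mulVec_transpose, mulVec_mulVec, hPP', smul_mulVec, one_mulVec,
      smul_dotProduct, smul_eq_mul]
  have hmem := resultant_charpoly_mem_sq (A.map φ) (by
      rw [IsSymm, ← transpose_map, hA.eq]) (Ideal.span {(p : W)}) v (σ a₀) j
    (WittVector.isUnit_of_coeff_zero_ne_zero _ (by
      have : π (v j) = _ := congrFun hπv j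
      intro h
      exact hj (this.symm.trans h)))
    (fun i => by
      rw [hker, map_sub, map_mul, hσ, RingHom.map_mulVec, hmapmap, hπv, hev, sub_eq_zero]
      change _ = a₀ * (π ∘ v) i
      rw [hπv]; rfl)
    (by rw [hform]; exact Ideal.mul_mem_right _ _ hl)
    (by
      change v ⬝ᵥ A.map φ *ᵥ (P.map φ *ᵥ c) ∈ _
      rw [mulVec_mulVec, hAP', ← mulVec_mulVec, hform]
      exact Ideal.mul_mem_right _ _ hl)
  rw [charpoly_map, derivative_map, resultant_map_map, ← hd, Ideal.span_singleton_pow,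
    Ideal.mem_span_singleton] at hmem
  obtain ⟨r, hr⟩ := hmem
  have hpd : (p : ℤ) ∣ d := by
    rw [← hψ, ← hπφ, hr, ← hker, sq, mul_assoc]
    exact Ideal.mul_mem_right _ _ (Ideal.mem_span_singleton_self _)
  obtain ⟨e, he⟩ := hpd
  have hφe : φ e = p * r := by
    have hp0 : (p : W) ≠ 0 := (WittVector.irreducible p).ne_zero
    refine mul_left_cancel₀ hp0 ?_
    rw [← mul_assoc, ← sq, ← hr, he, map_mul]
    simp [φ]
  have hpe : (p : ℤ) ∣ e := by
    rw [← hψ, ← hπφ, hφe, ← hker]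
    exact Ideal.mul_mem_right _ _ (Ideal.mem_span_singleton_self _)
  have hu := hsq p (by rw [he]; exact mul_dvd_mul_left _ hpe)
  exact (Nat.prime_iff_prime_int.1 hp.out).not_isUnit hu

/-- A rational orthogonal matrix taking a symmetric integer matrix whose characteristic polynomial
has square-free discriminant to an integer matrix is integral. -/
theorem isIntegral_of_squarefree_resultant {n : Type*} [Fintype n] [DecidableEq n]
    (A : Matrix n n ℤ) (hA : A.IsSymm) (Q : Matrix n n ℚ) (hQ : Qᵀ * Q = 1)
    (B : Matrix n n ℤ) (hB : Qᵀ * A.map ((↑) : ℤ → ℚ) * Q = B.map ((↑) : ℤ → ℚ))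
    (hsq : Squarefree
      (resultant A.charpoly A.charpoly.derivative (Fintype.card n) (Fintype.card n - 1))) :
    ∃ Z : Matrix n n ℤ, Z.map ((↑) : ℤ → ℚ) = Q := by
  have hex : ∃ l : ℕ, 0 < l ∧ ∃ P : Matrix n n ℤ, P.map ((↑) : ℤ → ℚ) = (l : ℚ) • Q := by
    refine ⟨∏ i, ∏ j, (Q i j).den, Finset.prod_pos fun i _ => Finset.prod_pos fun j _ =>
      (Q i j).den_pos, ?_⟩
    have : ∀ i j, ∃ z : ℤ, (z : ℚ) = ((∏ i, ∏ j, (Q i j).den : ℕ) : ℚ) * Q i j := by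
      intro i j
      obtain ⟨t, ht⟩ : (Q i j).den ∣ ∏ i, ∏ j, (Q i j).den :=
        (Finset.dvd_prod_of_mem (fun j => (Q i j).den) (Finset.mem_univ j)).trans
          (Finset.dvd_prod_of_mem (fun i => ∏ j, (Q i j).den) (Finset.mem_univ i))
      refine ⟨t * (Q i j).num, ?_⟩
      rw [ht]
      push_cast
      rw [mul_comm ((Q i j).den : ℚ), mul_assoc, Rat.den_mul_eq_num]
    choose P hP using this
    exact ⟨Matrix.of P, by ext i j; simpa using hP i j⟩
  obtain ⟨hlpos, P, hP⟩ := Nat.find_spec hex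
  have hmin := fun m => Nat.find_min (m := m) hex
  set l := Nat.find hex with hl
  clear_value l
  by_cases h1 : l = 1
  · exact ⟨P, by simpa [h1] using hP⟩
  exfalso
  obtain ⟨p, hp, hpl⟩ := Nat.exists_prime_and_dvd h1
  have : Fact p.Prime := ⟨hp⟩
  have hinj : Function.Injective fun N : Matrix n n ℤ => N.map ((↑) : ℤ → ℚ) :=
    Matrix.map_injective Int.cast_injective
  have hmul : ∀ M N : Matrix n n ℤ, (M * N).map ((↑) : ℤ → ℚ) =
      M.map ((↑) : ℤ → ℚ) * N.map ((↑) : ℤ → ℚ) := fun M N =>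
    Matrix.map_mul (f := Int.castRingHom ℚ)
  refine not_squarefree_resultant_charpoly A hA P B l p (by exact_mod_cast hpl) ?_ ?_ ?_ hsq
  · apply hinj
    simp only
    rw [hmul, transpose_map, hP, transpose_smul, smul_mul_smul_comm, hQ]
    ext i j
    rw [map_apply, smul_apply, smul_apply, one_apply, one_apply]
    split_ifs <;> simp [sq]
  · apply hinj
    simp only
    rw [hmul, hmul, hP, ← hB, smul_mul_assoc, ← mul_assoc, ← mul_assoc, mul_eq_one_comm.1 hQ,
      one_mul, mul_smul_comm]
  · by_contra! hdiv
    choose R hR using hdiv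
    obtain ⟨t, rfl⟩ := hpl
    have ht : 0 < t := Nat.pos_of_mul_pos_left hlpos
    refine hmin t ?_ ⟨ht, Matrix.of R, ?_⟩
    · exact lt_mul_of_one_lt_left ht hp.one_lt
    · ext i j
      have hp0 : (p : ℚ) ≠ 0 := by exact_mod_cast hp.ne_zero
      have := congrFun (congrFun hP i) j
      simp only [map_apply, hR, smul_apply, smul_eq_mul] at this
      push_cast at this
      rw [mul_assoc] at this
      simpa using mul_left_cancel₀ hp0 this

end Matrix

theorem existsUnique_ne_zero_of_sum_sq_eq_one {ι : Type*} [Fintype ι] (z : ι → ℤ)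
    (h : ∑ i, z i ^ 2 = 1) : (∃! i, z i ≠ 0) ∧ ∀ i, z i ≠ 0 → z i = 1 ∨ z i = -1 := by
  have hrest : ∀ i, z i ≠ 0 → z i ^ 2 = 1 ∧ ∀ j, j ≠ i → z j = 0 := by
    intro i hi
    have hs := Finset.add_sum_erase Finset.univ (fun i => z i ^ 2) (Finset.mem_univ i)
    have h0 : 0 ≤ ∑ j ∈ Finset.univ.erase i, z j ^ 2 := Finset.sum_nonneg fun j _ => sq_nonneg _
    have h1 : 0 < z i ^ 2 := by positivity
    simp only [h] at hs
    refine ⟨by lia, fun j hj => ?_⟩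
    have := (Finset.sum_eq_zero_iff_of_nonneg fun j _ => sq_nonneg (z j)).1
      (show ∑ j ∈ Finset.univ.erase i, z j ^ 2 = 0 by lia) j (by simp [hj])
    exact pow_eq_zero_iff two_ne_zero |>.1 this
  refine ⟨?_, fun i hi => by simpa using (hrest i hi).1⟩
  obtain ⟨i, hi⟩ : ∃ i, z i ≠ 0 := by
    by_contra! h0
    simp [h0] at h
  exact ⟨i, hi, fun j hj => by_contra fun hne => hj ((hrest i hi).2 j hne)⟩

theorem rootsEnum_spec {n : ℕ} {f : ℂ[X]} (hf : f.natDegree = n) :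
    f.roots = Multiset.map (rootsEnum n f) Finset.univ.val := by
  have h : ∃ α : Fin n → ℂ, f.roots = Multiset.map α Finset.univ.val := by
    have hcard : f.roots.toList.length = n := by
      rw [Multiset.length_toList, ← hf]
      exact (IsAlgClosed.splits f).natDegree_eq_card_roots.symm
    subst hcard
    refine ⟨fun i => f.roots.toList.get i, ?_⟩
    rw [Fin.univ_val_map, List.ofFn_get, Multiset.coe_toList]
  rw [rootsEnum, dif_pos h]
  exact h.choose_spec

/-- Up to sign, `polyDisc` is the resultant of the polynomial and its derivative. -/
theorem polyDisc_eq_or_eq_neg {n : ℕ} {f : ℂ[X]} (hm : f.Monic) (hf : f.natDegree = n) :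
    polyDisc n f = resultant f f.derivative n (n - 1) ∨
      polyDisc n f = -resultant f f.derivative n (n - 1) := by
  set α := rootsEnum n f with hα
  have hroots := rootsEnum_spec hf
  have hprod : f = ∏ i, (X - C (α i)) := by
    rw [(IsAlgClosed.splits f).eq_prod_roots_of_monic hm, hroots, Multiset.map_map]
    rfl
  have hres : resultant f f.derivative n (n - 1) =
      ∏ i, ∏ j ∈ Finset.univ.erase i, (α i - α j) := by
    have := resultant_eq_prod_eval f f.derivative (n - 1)
      (by rw [← hf]; exact natDegree_derivative_le f) (IsAlgClosed.splits f)
    rw [hf, hm.leadingCoeff, one_pow, one_mul, hroots, Multiset.map_map] at this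
    rw [this]
    refine Finset.prod_congr rfl fun i _ => ?_
    simp only [Function.comp_apply]
    rw [← hα]
    conv_lhs => rw [hprod]
    rw [derivative_prod_finset, eval_finsetSum, Finset.sum_eq_single i]
    · simp [eval_prod]
    · intro j _ hj
      rw [eval_mul, eval_prod, Finset.prod_eq_zero (Finset.mem_erase.2 ⟨hj.symm, Finset.mem_univ i⟩)
        (by simp), zero_mul]
    · simp
  have hsplit : ∏ i, ∏ j ∈ Finset.univ.erase i, (α i - α j) =
      (∏ i, ∏ j ∈ Finset.univ.filter (fun j => i < j), (α i - α j)) *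
      ∏ i, ∏ j ∈ Finset.univ.filter (fun j => i < j), (α j - α i) := by
    have h2 : ∏ i, ∏ j ∈ Finset.univ.filter (fun j => i < j), (α j - α i) =
        ∏ i, ∏ j ∈ Finset.univ.filter (fun j => j < i), (α i - α j) :=
      Finset.prod_comm' (by simp)
    rw [h2, ← Finset.prod_mul_distrib]
    refine Finset.prod_congr rfl fun i _ => ?_
    rw [← Finset.prod_union]
    · congr 1
      ext j
      simp [lt_or_lt_iff_ne, eq_comm]
    · exact Finset.disjoint_filter.2 fun j _ h h' => lt_asymm h h'
  set D := ∏ i, ∏ j ∈ Finset.univ.filter (fun j => i < j), (α i - α j) with hD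
  set D' := ∏ i, ∏ j ∈ Finset.univ.filter (fun j => i < j), (α j - α i) with hD'
  have hdisc : polyDisc n f = D ^ 2 := by
    simp only [polyDisc, hD, Finset.prod_pow, hα]
  have hsq : D' ^ 2 = D ^ 2 := by
    simp only [hD, hD', ← Finset.prod_pow]
    exact Finset.prod_congr rfl fun i _ => Finset.prod_congr rfl fun j _ => by ring
  rw [hdisc, hres, hsplit]
  rcases sq_eq_sq_iff_eq_or_eq_neg.1 hsq with h | h <;> rw [h]
  · left; ring
  · right; ring

theorem stmt13 {n : ℕ} (A : Matrix (Fin n) (Fin n) ℤ) (hA : A.IsSymm)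
    (Q : Matrix (Fin n) (Fin n) ℚ) (hQorth : Qᵀ * Q = 1)
    (hint : ∀ i j, ∃ z : ℤ, (Qᵀ * A.map ((↑) : ℤ → ℚ) * Q) i j = (z : ℚ))
    (d : ℤ) (hdodd : Odd d) (hdsf : Squarefree d)
    (hdisc : polyDisc n ((A.map ((↑) : ℤ → ℂ)).charpoly) = (d : ℂ)) :
    (∀ i, ∃! j, Q i j ≠ 0) ∧ (∀ j, ∃! i, Q i j ≠ 0) ∧
    ∀ i j, Q i j ≠ 0 → Q i j = 1 ∨ Q i j = -1 := by
  have hmap : A.map ((↑) : ℤ → ℂ) = A.map (Int.castRingHom ℂ) := rfl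
  set r := resultant A.charpoly A.charpoly.derivative n (n - 1) with hr
  have hsq : Squarefree r := by
    have h := polyDisc_eq_or_eq_neg (n := n) (A.map ((↑) : ℤ → ℂ)).charpoly_monic
      (by rw [charpoly_natDegree_eq_dim, Fintype.card_fin])
    rw [hdisc, hmap, charpoly_map, derivative_map, resultant_map_map, ← hr, eq_intCast] at h
    rcases h with h | h
    · rwa [← show d = r by exact_mod_cast h]
    · have hd : d = -r := by exact_mod_cast h
      rw [hd] at hdsf
      exact hdsf.squarefree_of_dvd (dvd_neg.2 dvd_rfl)
  choose B hB using hint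
  obtain ⟨Z, rfl⟩ := isIntegral_of_squarefree_resultant A hA Q hQorth (Matrix.of B)
    (by ext i j; exact hB i j) (by rw [Fintype.card_fin]; exact hsq)
  have hcol : ∀ j, ∑ i, Z i j ^ 2 = 1 := by
    intro j
    have := congrFun (congrFun hQorth j) j
    simp only [mul_apply, transpose_apply, map_apply, one_apply_eq, ← sq] at this
    exact_mod_cast this
  have hQorth' := mul_eq_one_comm.1 hQorth
  have hrow : ∀ i, ∑ j, Z i j ^ 2 = 1 := by
    intro i
    have := congrFun (congrFun hQorth' i) i
    simp only [mul_apply, transpose_apply, map_apply, one_apply_eq, ← sq] at this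
    exact_mod_cast this
  simp only [map_apply, ne_eq, Int.cast_eq_zero]
  refine ⟨fun i => (existsUnique_ne_zero_of_sum_sq_eq_one _ (hrow i)).1,
    fun j => (existsUnique_ne_zero_of_sum_sq_eq_one _ (hcol j)).1, fun i j h => ?_⟩
  exact_mod_cast (existsUnique_ne_zero_of_sum_sq_eq_one _ (hrow i)).2 j h
end
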